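/- Let m̃ ∈ R^{K+1} have first component 0, and suppose ã, b̃ ∈ R^{K+1} each have first component 1 and satisfy T(m̃)ã = Λã and T(m̃)b̃ = −Λb̃, where Λ = diag(0,1,...,K). Then T(ã)T(b̃) = I. -/

import Mathlib

open Matrix Finset

/-- Lower triangular Toeplitz matrix generated by a vector. -/
def LTT {n : ℕ} (x : Fin n → ℝ) : Matrix (Fin n) (Fin n) ℝ :=
  Matrix.of fun i j =>
    if h : (j : ℕ) ≤ (i : ℕ) then
      x ⟨(i : ℕ) - (j : ℕ), Nat.lt_of_le_of_lt (Nat.sub_le _ _) i.isLt⟩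
    else 0

/-- The diagonal matrix diag(0,1,...,n-1). -/
def Lam (n : ℕ) : Matrix (Fin n) (Fin n) ℝ :=
  Matrix.diagonal fun i => (i : ℝ)

/-- The vector of the first `n` coefficients of a power series. -/
noncomputable def coeffVec (n : ℕ) (f : PowerSeries ℝ) : Fin n → ℝ :=
  fun i => PowerSeries.coeff (i : ℕ) f

theorem exists_coeffVec_eq {n : ℕ} (x : Fin n → ℝ) : ∃ f, coeffVec n f = x :=
  ⟨PowerSeries.mk fun k => if h : k < n then x ⟨k, h⟩ else 0, by
    ext i
    simp [coeffVec]⟩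

theorem LTT_coeffVec_apply {n : ℕ} (f : PowerSeries ℝ) (i j : Fin n) :
    LTT (coeffVec n f) i j = PowerSeries.coeff (i : ℕ) (f * PowerSeries.X ^ (j : ℕ)) := by
  simp [LTT, coeffVec, PowerSeries.coeff_mul_X_pow']

theorem LTT_coeffVec_mulVec {n : ℕ} (f g : PowerSeries ℝ) :
    LTT (coeffVec n f) *ᵥ coeffVec n g = coeffVec n (f * g) := by
  ext i
  have hsum : (LTT (coeffVec n f) *ᵥ coeffVec n g) i =
      ∑ k ∈ range n, if k ≤ i then
        PowerSeries.coeff ((i : ℕ) - k) f * PowerSeries.coeff k g else 0 := by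
    rw [Finset.sum_range]
    simp only [mulVec, dotProduct]
    refine Finset.sum_congr rfl fun k _ => ?_
    simp [LTT, coeffVec]
  have hfilter : (range n).filter (fun k => k ≤ (i : ℕ)) = range ((i : ℕ) + 1) := by
    ext k
    simp only [Finset.mem_filter, Finset.mem_range]
    omega
  rw [hsum, ← Finset.sum_filter, hfilter, coeffVec, mul_comm f g, PowerSeries.coeff_mul,
    Finset.Nat.sum_antidiagonal_eq_sum_range_succ
      (fun k l => PowerSeries.coeff k g * PowerSeries.coeff l f)]
  exact Finset.sum_congr rfl fun k _ => mul_comm _ _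

theorem LTT_coeffVec_mul {n : ℕ} (f g : PowerSeries ℝ) :
    LTT (coeffVec n f) * LTT (coeffVec n g) = LTT (coeffVec n (f * g)) := by
  ext i j
  have hcol : (fun k => LTT (coeffVec n g) k j) =
      coeffVec n (g * PowerSeries.X ^ (j : ℕ)) :=
    funext fun k => LTT_coeffVec_apply g k j
  calc (LTT (coeffVec n f) * LTT (coeffVec n g)) i j
      = (LTT (coeffVec n f) *ᵥ fun k => LTT (coeffVec n g) k j) i := rfl
    _ = LTT (coeffVec n (f * g)) i j := by
      rw [hcol, LTT_coeffVec_mulVec, LTT_coeffVec_apply, mul_assoc, coeffVec]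

theorem LTT_coeffVec_one (n : ℕ) : LTT (coeffVec n 1) = 1 := by
  ext i j
  rw [LTT_coeffVec_apply, one_mul, PowerSeries.coeff_X_pow, Matrix.one_apply]
  simp [Fin.ext_iff]

/-- If, up to degree `n`, multiplication by `m` acts on `f` as the Euler operator and on `g` as its
negative, then the coefficient of degree `n ≠ 0` of `f * g` vanishes. -/
theorem coeff_mul_eq_zero_of_euler {m f g : PowerSeries ℝ} {n : ℕ} (hn : n ≠ 0)
    (hf : ∀ k ≤ n, PowerSeries.coeff k (m * f) = k * PowerSeries.coeff k f)
    (hg : ∀ k ≤ n, PowerSeries.coeff k (m * g) = -(k * PowerSeries.coeff k g)) :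
    PowerSeries.coeff n (f * g) = 0 := by
  have key : (n : ℝ) * PowerSeries.coeff n (f * g) =
      PowerSeries.coeff n (m * f * g) - PowerSeries.coeff n (f * (m * g)) := by
    simp only [PowerSeries.coeff_mul n]
    rw [Finset.mul_sum, ← Finset.sum_sub_distrib]
    refine Finset.sum_congr rfl fun p hp => ?_
    have hp' := Finset.HasAntidiagonal.mem_antidiagonal.mp hp
    rw [hf p.1 (by omega), hg p.2 (by omega), ← hp']
    push_cast
    ring
  rw [mul_left_comm f m g, mul_assoc, sub_self] at key
  exact (mul_eq_zero.mp key).resolve_left (Nat.cast_ne_zero.mpr hn)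

theorem toeplitz_ab_inverse {K : ℕ} (mt a b : Fin (K + 1) → ℝ)
    (hm0 : mt 0 = 0) (ha0 : a 0 = 1) (hb0 : b 0 = 1)
    (ha : LTT mt *ᵥ a = Lam (K + 1) *ᵥ a)
    (hb : LTT mt *ᵥ b = -(Lam (K + 1) *ᵥ b)) :
    LTT a * LTT b = 1 := by
  obtain ⟨m, rfl⟩ := exists_coeffVec_eq mt
  obtain ⟨f, rfl⟩ := exists_coeffVec_eq a
  obtain ⟨g, rfl⟩ := exists_coeffVec_eq b
  rw [LTT_coeffVec_mulVec] at ha hb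
  rw [LTT_coeffVec_mul, ← LTT_coeffVec_one]
  congr 1
  ext i
  have hf (k : ℕ) (hk : k ≤ i) : PowerSeries.coeff k (m * f) = k * PowerSeries.coeff k f := by
    simpa [coeffVec, Lam, mulVec_diagonal] using congrFun ha ⟨k, by omega⟩
  have hg (k : ℕ) (hk : k ≤ i) : PowerSeries.coeff k (m * g) = -(k * PowerSeries.coeff k g) := by
    simpa [coeffVec, Lam, mulVec_diagonal] using congrFun hb ⟨k, by omega⟩
  by_cases hi : (i : ℕ) = 0
  · simp only [coeffVec, Fin.val_zero, PowerSeries.coeff_zero_eq_constantCoeff] at ha0 hb0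
    simp [coeffVec, hi, ha0, hb0]
  · simp only [coeffVec]
    rw [coeff_mul_eq_zero_of_euler hi hf hg, PowerSeries.coeff_one, if_neg hi]
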